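/- arXiv:1801.06736 — 2 statements merged into one kernel-verified Lean document; each statement's English description precedes it below -/
import Mathlib

section
/- Let F be a field of characteristic 2, let n be even, and let P be an n×n matrix over ZMod 2 satisfying P * Pᵀ = 1 (P is a binary orthogonal matrix). Let a, b ∈ F be nonzero with a ≠ b, and set c = a / (a² + b²) and d = b / (a² + b²). Define the quasi-binary matrix A over F by A i j = b if P i j = 1 and A i j = a if P i j = 0, and define B over F by B i j = d if P j i = 1 and B i j = c if P j i = 0 (i.e., B is the transpose pattern of P with c, d substituted). Then A * B = 1 and B * A = 1; in particular A is invertible with A⁻¹ = B. -/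
open Matrix

theorem ZMod.ite_eq_one_eq_add_castHom {F : Type*} [Field F] [CharP F 2] (a b : F) (x : ZMod 2) :
    (if x = 1 then b else a) = a + (a + b) * ZMod.castHom (dvd_refl 2) F x := by
  have h2 : (2 : F) = 0 := CharTwo.two_eq_zero
  obtain rfl | rfl : x = 0 ∨ x = 1 := by revert x; decide
  · simp
  · rw [if_pos rfl, map_one]
    linear_combination -a * h2

/-- The rows of a binary orthogonal matrix have odd weight. -/
theorem Matrix.sum_row_eq_one_of_mul_transpose_eq_one {m : Type*} [Fintype m] [DecidableEq m]
    {P : Matrix m m (ZMod 2)} (hP : P * Pᵀ = 1) (i : m) : ∑ k, P i k = 1 := by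
  have h := congrFun (congrFun hP i) i
  rw [mul_apply, one_apply_eq] at h
  rw [← h]
  refine Finset.sum_congr rfl fun k _ => ?_
  rw [transpose_apply]
  generalize P i k = x
  revert x
  decide

/-- Theorem 1 of the paper: over a field `F` of characteristic `2`, if `P` is
an `n × n` binary orthogonal matrix (`n` even), `a, b` are distinct nonzero
elements of `F`, `c = a / (a² + b²)`, `d = b / (a² + b²)`, `A` is the
quasi-binary matrix `P_{a,b}` and `B` is the transpose pattern of `P` with
`c, d` substituted, then `A * B = 1`, `B * A = 1`, and `A⁻¹ = B`. -/
theorem quasi_binary_quasi_orthogonal_inverse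
    (F : Type*) [Field F] [CharP F 2] (n : ℕ) (hn : Even n)
    (P : Matrix (Fin n) (Fin n) (ZMod 2)) (hP : P * Pᵀ = 1)
    (a b : F) (ha : a ≠ 0) (hb : b ≠ 0) (hab : a ≠ b)
    (c d : F) (hc : c = a / (a ^ 2 + b ^ 2)) (hd : d = b / (a ^ 2 + b ^ 2))
    (A B : Matrix (Fin n) (Fin n) F)
    (hA : ∀ i j, A i j = if P i j = 1 then b else a)
    (hB : ∀ i j, B i j = if P j i = 1 then d else c) :
    A * B = 1 ∧ B * A = 1 ∧ A⁻¹ = B := by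
  have h2 : (2 : F) = 0 := CharTwo.two_eq_zero
  have hs : a + b ≠ 0 := fun h => hab (CharTwo.add_eq_zero.mp h)
  have hsq : a ^ 2 + b ^ 2 = (a + b) ^ 2 := (CharTwo.add_sq a b).symm
  have hn0 : (n : F) = 0 := (CharP.cast_eq_zero_iff F 2 n).mpr hn.two_dvd
  set f := ZMod.castHom (dvd_refl 2) F
  have hrow (i : Fin n) : ∑ k, f (P i k) = 1 := by
    rw [← map_sum, sum_row_eq_one_of_mul_transpose_eq_one hP, map_one]
  have hAB : A * B = 1 := by
    ext i j
    have hij : ∑ k, f (P i k) * f (P j k) = (1 : Matrix (Fin n) (Fin n) F) i j := by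
      have h := congrArg f (congrFun (congrFun hP i) j)
      simpa [mul_apply, one_apply, apply_ite f] using h
    have hterm (k : Fin n) : A i k * B k j =
        ((a + b) ^ 2)⁻¹ * (a ^ 2 + a * (a + b) * (f (P i k) + f (P j k)) +
          (a + b) ^ 2 * (f (P i k) * f (P j k))) := by
      rw [hA, hB, ZMod.ite_eq_one_eq_add_castHom, ZMod.ite_eq_one_eq_add_castHom, hc, hd, hsq]
      ring
    rw [mul_apply, Finset.sum_congr rfl fun k _ => hterm k, ← Finset.mul_sum,
      Finset.sum_add_distrib, Finset.sum_add_distrib, ← Finset.mul_sum, ← Finset.mul_sum,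
      Finset.sum_add_distrib, hrow, hrow, hij, Finset.sum_const, Finset.card_univ,
      Fintype.card_fin, nsmul_eq_mul, hn0, one_add_one_eq_two, h2, zero_mul, mul_zero,
      zero_add, zero_add, inv_mul_cancel_left₀ (pow_ne_zero 2 hs)]
  exact ⟨hAB, mul_eq_one_comm.mp hAB, inv_eq_right_inv hAB⟩
end

section
/- Let F be a field of characteristic 2, let n be even, and let P be an n×n matrix over ZMod 2 satisfying P * Pᵀ = 1. Let a, b ∈ F be nonzero with a ≠ b, and define the quasi-binary matrix A over F by A i j = b if P i j = 1 and A i j = a if P i j = 0. Then A is invertible, and every entry of A⁻¹ equals either a/(a²+b²) or b/(a²+b²); in particular, the inverse of a quasi-binary quasi-orthogonal matrix is itself a matrix with only two distinct entry values. -/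
open Matrix

/-- The rows of an orthogonal matrix over `ZMod 2` have odd weight. -/
theorem row_sum_eq_one_of_mul_transpose_eq_one {ι : Type*} [Fintype ι] [DecidableEq ι]
    {P : Matrix ι ι (ZMod 2)} (hP : P * Pᵀ = 1) (i : ι) : ∑ k, P i k = 1 := by
  have sq : ∀ x : ZMod 2, x * x = x := by decide
  simpa [Matrix.mul_apply, sq] using congrFun (congrFun hP i) i

/-- A quasi-binary matrix of even order whose pattern is orthogonal is quasi-orthogonal. -/
theorem quasi_binary_mul_transpose {ι F : Type*} [Fintype ι] [DecidableEq ι] [Field F]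
    [CharP F 2] (hn : Even (Fintype.card ι)) {P : Matrix ι ι (ZMod 2)} (hP : P * Pᵀ = 1)
    (a b : F) {A : Matrix ι ι F} (hA : ∀ i j, A i j = if P i j = 1 then b else a) :
    A * Aᵀ = (a ^ 2 + b ^ 2) • (1 : Matrix ι ι F) := by
  let φ : ZMod 2 →+* F := ZMod.castHom dvd_rfl F
  have entry : ∀ i j, A i j = a + (a + b) * φ (P i j) := by
    intro i j
    have hx : ∀ x : ZMod 2, x = 0 ∨ x = 1 := by decide
    rw [hA]
    rcases hx (P i j) with h | h
    · simp [h]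
    · simp [h, ← add_assoc, CharTwo.add_self_eq_zero]
  have row : ∀ i, ∑ k, φ (P i k) = 1 := fun i => by
    rw [← map_sum, row_sum_eq_one_of_mul_transpose_eq_one hP, map_one]
  have gram : ∀ i j, ∑ k, φ (P i k) * φ (P j k) = (1 : Matrix ι ι F) i j := fun i j => by
    have h := congrArg φ (congrFun (congrFun hP i) j)
    simpa [Matrix.mul_apply, Matrix.one_apply, apply_ite φ] using h
  have card : (Fintype.card ι : F) = 0 :=
    (CharP.cast_eq_zero_iff F 2 _).2 hn.two_dvd
  ext i j
  calc (A * Aᵀ) i j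
      = ∑ k, (a ^ 2 + a * (a + b) * φ (P i k) + a * (a + b) * φ (P j k)
          + (a + b) ^ 2 * (φ (P i k) * φ (P j k))) := by
        simp only [Matrix.mul_apply, Matrix.transpose_apply, entry]
        exact Finset.sum_congr rfl fun k _ => by ring
    _ = ((a ^ 2 + b ^ 2) • (1 : Matrix ι ι F)) i j := by
        simp only [Finset.sum_add_distrib, ← Finset.mul_sum, row, gram, Finset.sum_const,
          Finset.card_univ, nsmul_eq_mul, card, Matrix.smul_apply, smul_eq_mul]
        rw [zero_mul, zero_add, CharTwo.add_self_eq_zero, zero_add, CharTwo.add_sq]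

/-- Invertibility corollary of Theorem 1: the quasi-binary matrix `P_{a,b}`
associated with a binary orthogonal matrix `P` (over a field of characteristic
2, with `n` even and `a, b` distinct nonzero) is invertible, and every entry
of its inverse equals either `a/(a²+b²)` or `b/(a²+b²)`. -/
theorem quasi_binary_inverse_is_two_valued
    (F : Type*) [Field F] [CharP F 2] (n : ℕ) (hn : Even n)
    (P : Matrix (Fin n) (Fin n) (ZMod 2)) (hP : P * Pᵀ = 1)
    (a b : F) (ha : a ≠ 0) (hb : b ≠ 0) (hab : a ≠ b)
    (A : Matrix (Fin n) (Fin n) F)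
    (hA : ∀ i j, A i j = if P i j = 1 then b else a) :
    IsUnit A ∧
      ∀ i j : Fin n, A⁻¹ i j = a / (a ^ 2 + b ^ 2) ∨
        A⁻¹ i j = b / (a ^ 2 + b ^ 2) := by
  have hs : a ^ 2 + b ^ 2 ≠ 0 := by
    rw [← CharTwo.add_sq]
    exact pow_ne_zero 2 fun h => hab (CharTwo.add_eq_zero.1 h)
  have hmul : A * ((a ^ 2 + b ^ 2)⁻¹ • Aᵀ) = 1 := by
    rw [Matrix.mul_smul, quasi_binary_mul_transpose (by simpa using hn) hP a b hA, smul_smul,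
      inv_mul_cancel₀ hs, one_smul]
  refine ⟨IsUnit.of_mul_eq_one _ hmul, fun i j => ?_⟩
  rw [Matrix.inv_eq_right_inv hmul, Matrix.smul_apply, Matrix.transpose_apply, hA, smul_eq_mul,
    ← div_eq_inv_mul]
  split_ifs
  · exact Or.inr rfl
  · exact Or.inl rfl
end
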